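/- arXiv:2402.06108 — 2 statements merged into one kernel-verified Lean document; each statement's English description precedes it below -/
import Mathlib

section
/- Let G¹ and G² be real symmetric N×N matrices such that I + G¹ is positive definite, and let κ ∈ (0,1]. If (1−κ)·‖I + G²‖₂ < κ·λ_min(I + G¹), then I + κ·G¹ + (1−κ)·G² is positive definite, and hence a P-matrix (so the multiplex network game has a unique Nash equilibrium). -/
/-- `M` is a P-matrix: every principal submatrix (obtained by keeping the rows and
columns indexed by a set `s`) has strictly positive determinant. -/
def IsPMatrix {m : Type*} [Fintype m] [DecidableEq m] (M : Matrix m m ℝ) : Prop :=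
  ∀ s : Finset m,
    0 < (M.submatrix (fun i : s => (i : m)) (fun j : s => (j : m))).det

/-- `z` is a solution of the linear complementarity problem LCP(M, b). -/
def IsLCPSolution {m : Type*} [Fintype m] (M : Matrix m m ℝ) (b z : m → ℝ) : Prop :=
  (∀ i, 0 ≤ z i) ∧ (∀ i, 0 ≤ M.mulVec z i + b i) ∧ (∀ i, z i * (M.mulVec z i + b i) = 0)

/-- The smallest eigenvalue of a real symmetric (Hermitian) matrix. -/
noncomputable def eigMin {m : Type*} [Fintype m] [DecidableEq m] {A : Matrix m m ℝ}
    (hA : A.IsHermitian) : ℝ := ⨅ i, hA.eigenvalues i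

/-- The largest eigenvalue of a real symmetric (Hermitian) matrix. -/
noncomputable def eigMax {m : Type*} [Fintype m] [DecidableEq m] {A : Matrix m m ℝ}
    (hA : A.IsHermitian) : ℝ := ⨆ i, hA.eigenvalues i

/-- The spectral (operator 2-) norm of a real matrix. -/
noncomputable def specNorm {m : Type*} [Fintype m] [DecidableEq m] (A : Matrix m m ℝ) : ℝ :=
  ‖Matrix.toEuclideanCLM (𝕜 := ℝ) A‖

open scoped MatrixOrder in
/-- The Rayleigh quotient of a real symmetric matrix is bounded below by its least eigenvalue. -/
lemma eigMin_mul_dotProduct_self_le {m : Type*} [Fintype m] [DecidableEq m] {A : Matrix m m ℝ}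
    (hA : A.IsHermitian) (x : m → ℝ) : eigMin hA * (x ⬝ᵥ x) ≤ x ⬝ᵥ A.mulVec x := by
  have hle : algebraMap ℝ (Matrix m m ℝ) (eigMin hA) ≤ A := by
    rw [algebraMap_le_iff_le_spectrum (a := A) hA, hA.spectrum_real_eq_range_eigenvalues]
    rintro _ ⟨i, rfl⟩
    exact ciInf_le (Set.finite_range _).bddBelow i
  have hnonneg := (Matrix.le_iff.mp hle).dotProduct_mulVec_nonneg x
  simp only [star_trivial, Matrix.sub_mulVec, dotProduct_sub, Algebra.algebraMap_eq_smul_one,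
    Matrix.smul_mulVec, Matrix.one_mulVec, dotProduct_smul, smul_eq_mul] at hnonneg
  linarith

/-- The quadratic form of a real matrix is bounded below through the spectral norm. -/
lemma neg_specNorm_mul_dotProduct_self_le {m : Type*} [Fintype m] [DecidableEq m]
    (A : Matrix m m ℝ) (x : m → ℝ) : -(specNorm A * (x ⬝ᵥ x)) ≤ x ⬝ᵥ A.mulVec x := by
  let v : EuclideanSpace ℝ m := WithLp.toLp 2 x
  have hv : ‖v‖ * ‖v‖ = x ⬝ᵥ x := by
    rw [← real_inner_self_eq_norm_mul_norm]
    rw [EuclideanSpace.inner_eq_star_dotProduct, star_trivial]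
  have hinner : inner ℝ v (Matrix.toEuclideanCLM (𝕜 := ℝ) A v) = x ⬝ᵥ A.mulVec x :=
    Matrix.inner_toEuclideanCLM A v v
  have hop := (Matrix.toEuclideanCLM (𝕜 := ℝ) A).le_opNorm v
  have hcs := abs_real_inner_le_norm v (Matrix.toEuclideanCLM (𝕜 := ℝ) A v)
  rw [hinner] at hcs
  have hmul := mul_le_mul_of_nonneg_left hop (norm_nonneg v)
  rw [← hv, specNorm]
  linarith [neg_abs_le (x ⬝ᵥ A.mulVec x)]

lemma Matrix.PosDef.isPMatrix {m : Type*} [Fintype m] [DecidableEq m] {M : Matrix m m ℝ}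
    (hM : M.PosDef) : IsPMatrix M := fun _ =>
  (hM.submatrix Subtype.val_injective).det_pos

lemma IsLCPSolution.eq {m : Type*} [Fintype m] {M : Matrix m m ℝ} (hM : M.PosDef)
    {b z z' : m → ℝ} (hz : IsLCPSolution M b z) (hz' : IsLCPSolution M b z') : z = z' := by
  by_contra hne
  have hpos := hM.dotProduct_mulVec_pos (sub_ne_zero.mpr hne)
  refine hpos.not_ge (Finset.sum_nonpos fun i _ => ?_)
  simp only [star_trivial, Matrix.mulVec_sub, Pi.sub_apply]
  nlinarith [hz.2.2 i, hz'.2.2 i, mul_nonneg (hz.1 i) (hz'.2.1 i), mul_nonneg (hz'.1 i) (hz.2.1 i)]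

/-- A solution of the variational inequality on the nonnegative orthant solves the linear
complementarity problem. -/
lemma isLCPSolution_of_variational {m : Type*} [Fintype m] [DecidableEq m] {M : Matrix m m ℝ}
    {b z : m → ℝ} (hz : ∀ i, 0 ≤ z i)
    (hvar : ∀ x : m → ℝ, (∀ i, 0 ≤ x i) → 0 ≤ (M.mulVec z + b) ⬝ᵥ (x - z)) :
    IsLCPSolution M b z := by
  have hgrad : ∀ i, 0 ≤ M.mulVec z i + b i := fun i => by
    have hi := hvar (z + Pi.single i 1) fun j => add_nonneg (hz j) (by
      by_cases hij : j = i <;> simp [hij])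
    simpa using hi
  refine ⟨hz, hgrad, fun i => ?_⟩
  have hsum : ∑ j, z j * (M.mulVec z j + b j) ≤ 0 := by
    have h0 := hvar 0 fun _ => le_rfl
    rw [zero_sub, dotProduct_neg] at h0
    simp only [dotProduct, Pi.add_apply] at h0
    simp only [mul_comm (z _)]
    linarith
  have hterm : ∀ j ∈ Finset.univ, 0 ≤ z j * (M.mulVec z j + b j) := fun j _ =>
    mul_nonneg (hz j) (hgrad j)
  exact (Finset.sum_eq_zero_iff_of_nonneg hterm).mp
    (le_antisymm hsum (Finset.sum_nonneg hterm)) i (Finset.mem_univ i)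

open scoped MatrixOrder in
lemma Matrix.PosDef.exists_isLCPSolution {m : Type*} [Fintype m] [DecidableEq m]
    {M : Matrix m m ℝ} (hM : M.PosDef) (b : m → ℝ) : ∃ z, IsLCPSolution M b z := by
  let S := CFC.sqrt M
  have hSS : S * S = M := CFC.sqrt_mul_sqrt_self M hM.posSemidef.nonneg
  have hST : S.transpose = S := (Matrix.nonneg_iff_posSemidef.mp (CFC.sqrt_nonneg M)).isHermitian
  have hdet : IsUnit S.det := by
    have hMdet := hM.det_pos.ne'
    rw [← hSS, Matrix.det_mul] at hMdet
    exact (left_ne_zero_of_mul hMdet).isUnit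
  let K : Set (EuclideanSpace ℝ m) := {w | ∀ i, 0 ≤ S⁻¹.mulVec w.ofLp i}
  have hclosed : IsClosed K := by
    simp only [K, Set.ofPred_forall]
    refine isClosed_iInter fun i => isClosed_le continuous_const ?_
    simp only [Matrix.mulVec, dotProduct]
    fun_prop
  have hconvex : Convex ℝ K := by
    intro x hx y hy s t hs ht _ i
    simpa [Matrix.mulVec_add, Matrix.mulVec_smul] using
      add_nonneg (mul_nonneg hs (hx i)) (mul_nonneg ht (hy i))
  let u : EuclideanSpace ℝ m := WithLp.toLp 2 (-S⁻¹.mulVec b)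
  obtain ⟨v, hvK, hv⟩ := exists_norm_eq_iInf_of_complete_convex ⟨0, by simp [K]⟩
    hclosed.isComplete hconvex u
  rw [norm_eq_iInf_iff_real_inner_le_zero hconvex hvK] at hv
  refine ⟨S⁻¹.mulVec v.ofLp, isLCPSolution_of_variational hvK fun x hx => ?_⟩
  have hxv := hv (WithLp.toLp 2 (S.mulVec x)) (by
    simpa [K, Matrix.mulVec_mulVec, Matrix.nonsing_inv_mul _ hdet] using hx)
  set z := S⁻¹.mulVec v.ofLp with hz
  have hvz : v.ofLp = S.mulVec z := by
    rw [hz, Matrix.mulVec_mulVec, Matrix.mul_nonsing_inv _ hdet, Matrix.one_mulVec]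
  have hgrad : S.mulVec (S.mulVec z + S⁻¹.mulVec b) = M.mulVec z + b := by
    rw [Matrix.mulVec_add, Matrix.mulVec_mulVec z, Matrix.mulVec_mulVec b, hSS,
      Matrix.mul_nonsing_inv _ hdet, Matrix.one_mulVec]
  have hadj : (M.mulVec z + b) ⬝ᵥ (x - z) =
      (S.mulVec z + S⁻¹.mulVec b) ⬝ᵥ (S.mulVec x - S.mulVec z) := by
    rw [← hgrad, ← Matrix.mulVec_sub, Matrix.dotProduct_mulVec, ← Matrix.mulVec_transpose, hST]
  have hinner : inner ℝ (u - v) (WithLp.toLp 2 (S.mulVec x) - v) =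
      -((S.mulVec z + S⁻¹.mulVec b) ⬝ᵥ (S.mulVec x - S.mulVec z)) := by
    rw [EuclideanSpace.inner_eq_star_dotProduct, star_trivial, dotProduct_comm,
      ← neg_dotProduct, WithLp.ofLp_sub, WithLp.ofLp_sub, hvz]
    congr 1
    simp only [u]
    abel
  rw [hadj]
  linarith

/-- If `I + G¹` is (symmetric) positive definite, `κ ∈ (0,1]`, and
`(1−κ)·‖I + G²‖₂ < κ·λ_min(I + G¹)`, then `I + κ G¹ + (1−κ) G²` is positive definite,
hence a P-matrix, and the multiplex network game has a unique Nash equilibrium. -/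
theorem multiplex_posDef_of_weak_second_layer {N : ℕ} (G1 G2 : Matrix (Fin N) (Fin N) ℝ)
    (hG1 : G1.IsHermitian) (hG2 : G2.IsHermitian)
    (hpd : (1 + G1).PosDef) (κ : ℝ) (hκ : κ ∈ Set.Ioc (0 : ℝ) 1)
    (h : (1 - κ) * specNorm (1 + G2) < κ * eigMin hpd.1) :
    (1 + (κ • G1 + (1 - κ) • G2)).PosDef ∧
      IsPMatrix (1 + (κ • G1 + (1 - κ) • G2)) ∧
      ∀ q : Fin N → ℝ, ∃! z : Fin N → ℝ,
        IsLCPSolution (1 + (κ • G1 + (1 - κ) • G2)) (-q) z := by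
  have hform : 1 + (κ • G1 + (1 - κ) • G2) = κ • (1 + G1) + (1 - κ) • (1 + G2) := by
    module
  have hM : (1 + (κ • G1 + (1 - κ) • G2)).PosDef := by
    have htrivial (c : ℝ) : IsSelfAdjoint c := star_trivial c
    refine .of_dotProduct_mulVec_pos
      (Matrix.isHermitian_one.add ((hG1.smul (htrivial κ)).add (hG2.smul (htrivial _))))
      fun x hx => ?_
    have hxx : 0 < x ⬝ᵥ x := by simpa using Matrix.dotProduct_star_self_pos_iff.mpr hx
    rw [hform, star_trivial, Matrix.add_mulVec, Matrix.smul_mulVec, Matrix.smul_mulVec,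
      dotProduct_add, dotProduct_smul, dotProduct_smul, smul_eq_mul, smul_eq_mul]
    have h1 := mul_le_mul_of_nonneg_left (eigMin_mul_dotProduct_self_le hpd.1 x) hκ.1.le
    have h2 := mul_le_mul_of_nonneg_left (neg_specNorm_mul_dotProduct_self_le (1 + G2) x)
      (sub_nonneg.mpr hκ.2)
    linarith [mul_lt_mul_of_pos_right h hxx]
  refine ⟨hM, hM.isPMatrix, fun q => ?_⟩
  obtain ⟨z, hz⟩ := hM.exists_isLCPSolution (-q)
  exact ⟨z, hz, fun z' hz' => hz'.eq hM hz⟩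
end

section
/- Let A be a real (n+m)×(n+m) P-matrix written in block form with an n×n top-left block A₁₁, blocks A₁₂, A₂₁, and an m×m bottom-right block A₂₂. Then A₁₁ is invertible and the Schur complement A₂₂ − A₂₁·A₁₁⁻¹·A₁₂ is a P-matrix. -/
theorem IsPMatrix.det_submatrix_pos {m k : Type*} [Fintype m] [DecidableEq m]
    [Fintype k] [DecidableEq k] {M : Matrix m m ℝ} (hM : IsPMatrix M) {f : k → m}
    (hf : Function.Injective f) : 0 < (M.submatrix f f).det := by
  let e : k ≃ (Finset.univ.image f : Finset m) :=
    Equiv.ofBijective (fun x => ⟨f x, Finset.mem_image_of_mem f (Finset.mem_univ x)⟩)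
      ⟨fun x y h => hf (congrArg Subtype.val h), fun ⟨y, hy⟩ => by
        obtain ⟨x, -, rfl⟩ := Finset.mem_image.1 hy
        exact ⟨x, rfl⟩⟩
  have h := hM (Finset.univ.image f)
  rwa [← Matrix.det_submatrix_equiv_self e] at h

/-- For a P-matrix written in block form, the top-left block is
invertible and the Schur complement `A₂₂ − A₂₁ A₁₁⁻¹ A₁₂` is a P-matrix. -/
theorem schur_complement_pMatrix {n m : ℕ}
    (A11 : Matrix (Fin n) (Fin n) ℝ) (A12 : Matrix (Fin n) (Fin m) ℝ)
    (A21 : Matrix (Fin m) (Fin n) ℝ) (A22 : Matrix (Fin m) (Fin m) ℝ)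
    (hA : IsPMatrix (Matrix.fromBlocks A11 A12 A21 A22)) :
    IsUnit A11 ∧ IsPMatrix (A22 - A21 * A11⁻¹ * A12) := by
  have hdet : 0 < A11.det := hA.det_submatrix_pos Sum.inl_injective
  have hunit : IsUnit A11 := (Matrix.isUnit_iff_isUnit_det A11).2 hdet.ne'.isUnit
  refine ⟨hunit, fun s => ?_⟩
  have := hunit.invertible
  let g : s → Fin m := fun i => i
  have h := hA.det_submatrix_pos
    (Function.Injective.sumMap Function.injective_id (Subtype.val_injective : g.Injective))
  have hblocks : (Matrix.fromBlocks A11 A12 A21 A22).submatrix (Sum.map id g) (Sum.map id g) =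
      Matrix.fromBlocks A11 (A12.submatrix id g) (A21.submatrix g id) (A22.submatrix g g) := by
    ext (i | i) (j | j) <;> rfl
  rw [hblocks, Matrix.det_fromBlocks₁₁, Matrix.invOf_eq_nonsing_inv] at h
  exact pos_of_mul_pos_right h hdet.le
end
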